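/- Let t > 0 and let f be absolutely continuous on [0,t] with I_t(f) < ∞. For x ∈ ℝ define the shifted path f^{(x)}(s) = x − f(0) + f(s). Then I_t(f^{(x)}) is finite for all x in a neighborhood of f(0) and I_t(f^{(x)}) → I_t(f) as x → f(0). -/

import Mathlib

open MeasureTheory Real Filter Set

noncomputable def Hfun (G : ℝ → ℝ) (α : ℝ) : ℝ := ∫ y : ℝ, (Real.exp (α * y) - 1) * G y

/-- `L(x,v) = sup_{α ∈ ℝ} (α v − p(x) H(α))`. -/
noncomputable def Lfun (G p : ℝ → ℝ) (x v : ℝ) : ℝ := ⨆ α : ℝ, (α * v - p x * Hfun G α)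

section aux

variable {G : ℝ → ℝ}

lemma aux_int (hGint : Integrable G)
    (hGexp : ∀ α : ℝ, Integrable (fun y => Real.exp (α * y) * G y)) (α : ℝ) :
    Integrable (fun y => (Real.exp (α * y) - 1) * G y) := by
  have := (hGexp α).sub hGint
  refine this.congr (Eventually.of_forall fun y => ?_)
  simp only [Pi.sub_apply]
  ring

lemma aux_cosh_int (hGint : Integrable G)
    (hGexp : ∀ α : ℝ, Integrable (fun y => Real.exp (α * y) * G y)) (α : ℝ) :
    Integrable (fun y => (Real.cosh (α * y) - 1) * G y) := by
  have := ((aux_int hGint hGexp α).add (aux_int hGint hGexp (-α))).const_mul (1/2)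
  refine this.congr (Eventually.of_forall fun y => ?_)
  simp only [Pi.add_apply, Real.cosh_eq, neg_mul]
  ring

lemma aux_H (hGeven : ∀ y, G (-y) = G y) (hGint : Integrable G)
    (hGexp : ∀ α : ℝ, Integrable (fun y => Real.exp (α * y) * G y)) (α : ℝ) :
    Hfun G α = ∫ y : ℝ, (Real.cosh (α * y) - 1) * G y := by
  have h1 : Hfun G α = Hfun G (-α) := by
    unfold Hfun
    rw [← integral_neg_eq_self]
    simp [hGeven]
  have h2 : Hfun G α = (1/2) * (Hfun G α + Hfun G (-α)) := by rw [← h1]; ring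
  rw [h2]
  unfold Hfun
  rw [← integral_add (aux_int hGint hGexp α) (aux_int hGint hGexp (-α)), ← integral_const_mul]
  congr 1
  ext y
  simp only [Real.cosh_eq, neg_mul]
  ring

lemma aux_cosh (z : ℝ) : z ^ 2 / 2 ≤ Real.cosh z - 1 := by
  have h1 : Real.cosh z = 2 * Real.sinh (z / 2) ^ 2 + 1 := by
    have h := Real.cosh_two_mul (z / 2)
    rw [mul_div_cancel₀ _ (two_ne_zero), Real.cosh_sq] at h
    linarith
  have h2 : (z / 2) ^ 2 ≤ Real.sinh (z / 2) ^ 2 := by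
    rcases le_total 0 (z / 2) with h | h
    · have := Real.self_le_sinh_iff.2 h
      nlinarith
    · have := Real.sinh_le_self_iff.2 h
      nlinarith
  linarith

lemma aux_H_double (hGpos : ∀ y, 0 < G y) (hGeven : ∀ y, G (-y) = G y) (hGint : Integrable G)
    (hGexp : ∀ α : ℝ, Integrable (fun y => Real.exp (α * y) * G y)) (α : ℝ) :
    4 * Hfun G α ≤ Hfun G (2 * α) := by
  rw [aux_H hGeven hGint hGexp, aux_H hGeven hGint hGexp, ← integral_const_mul]
  refine integral_mono ((aux_cosh_int hGint hGexp α).const_mul 4)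
    (aux_cosh_int hGint hGexp (2 * α)) fun y => ?_
  have h : 4 * (Real.cosh (α * y) - 1) ≤ Real.cosh (2 * α * y) - 1 := by
    rw [mul_assoc, Real.cosh_two_mul]
    nlinarith [Real.cosh_sq (α * y), sq_nonneg (Real.cosh (α * y) - 1)]
  have := mul_le_mul_of_nonneg_right h (hGpos y).le
  simp only
  linarith

lemma aux_H_quad (hGcont : Continuous G) (hGpos : ∀ y, 0 < G y) (hGeven : ∀ y, G (-y) = G y)
    (hGint : Integrable G)
    (hGexp : ∀ α : ℝ, Integrable (fun y => Real.exp (α * y) * G y)) :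
    ∃ m > 0, ∀ α, m * α ^ 2 ≤ Hfun G α := by
  refine ⟨(∫ y in (1:ℝ)..2, G y) / 2, ?_, fun α => ?_⟩
  · exact half_pos (intervalIntegral.intervalIntegral_pos_of_pos
      (hGcont.intervalIntegrable _ _) hGpos (by norm_num))
  · rw [aux_H hGeven hGint hGexp, intervalIntegral.integral_of_le (by norm_num)]
    have h0 : 0 ≤ fun y => (Real.cosh (α * y) - 1) * G y := fun y =>
      mul_nonneg (by linarith [Real.one_le_cosh (α * y)]) (hGpos y).le
    refine le_trans ?_ (setIntegral_le_integral (s := Ioc 1 2) (aux_cosh_int hGint hGexp α)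
      (Eventually.of_forall h0))
    have : (∫ y in Ioc (1:ℝ) 2, G y) / 2 * α ^ 2 = ∫ y in Ioc (1:ℝ) 2, (α ^ 2 / 2) * G y := by
      rw [integral_const_mul]; ring
    rw [this]
    refine setIntegral_mono_on (hGint.integrableOn.const_mul _)
      (aux_cosh_int hGint hGexp α).integrableOn measurableSet_Ioc fun y hy => ?_
    refine mul_le_mul_of_nonneg_right ?_ (hGpos y).le
    refine le_trans ?_ (aux_cosh (α * y))
    have : 1 ≤ y ^ 2 := by nlinarith [hy.1]
    rw [mul_pow]
    nlinarith [sq_nonneg α]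

/-- The Legendre-type function with explicit rate. -/
noncomputable def phi (H : ℝ → ℝ) (q v : ℝ) : ℝ := ⨆ α : ℝ, (α * v - q * H α)

variable {H : ℝ → ℝ}

lemma phi_bdd {m : ℝ} (hm : 0 < m) (hH : ∀ α, m * α ^ 2 ≤ H α) {q : ℝ} (hq : 0 < q) (v : ℝ) :
    BddAbove (range fun α : ℝ => α * v - q * H α) := by
  refine ⟨v ^ 2 / (4 * (q * m)), ?_⟩
  rintro _ ⟨α, rfl⟩
  have hqm := mul_pos hq hm
  have h1 : q * (m * α ^ 2) ≤ q * H α := mul_le_mul_of_nonneg_left (hH α) hq.le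
  simp only
  rw [le_div_iff₀ (by positivity)]
  have h2 : (α * v - q * H α) * (4 * (q * m)) ≤ (α * v - q * (m * α ^ 2)) * (4 * (q * m)) :=
    mul_le_mul_of_nonneg_right (by linarith) (by positivity)
  nlinarith [sq_nonneg (2 * (q * m) * α - v)]

lemma phi_anti {m : ℝ} (hm : 0 < m) (hH : ∀ α, m * α ^ 2 ≤ H α) {q r : ℝ} (hq : 0 < q)
    (hqr : q ≤ r) (v : ℝ) : phi H r v ≤ phi H q v := by
  refine ciSup_le fun α => le_trans ?_ (le_ciSup (phi_bdd hm hH hq v) α)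
  have : 0 ≤ H α := le_trans (by positivity) (hH α)
  nlinarith

lemma phi_half {m : ℝ} (hm : 0 < m) (hH : ∀ α, m * α ^ 2 ≤ H α)
    (hd : ∀ α, 4 * H α ≤ H (2 * α)) {q : ℝ} (hq : 0 < q) (v : ℝ) :
    phi H q v ≤ 2 * phi H (2 * q) v := by
  refine ciSup_le fun α => ?_
  have h := le_ciSup (phi_bdd hm hH (by positivity : 0 < 2 * q) v) (α / 2)
  have h2 := hd (α / 2)
  rw [mul_div_cancel₀ _ (two_ne_zero)] at h2
  have h3 := mul_le_mul_of_nonneg_left h2 hq.le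
  change _ ≤ phi H (2 * q) v at h
  linarith

lemma phi_pow {m : ℝ} (hm : 0 < m) (hH : ∀ α, m * α ^ 2 ≤ H α)
    (hd : ∀ α, 4 * H α ≤ H (2 * α)) {q : ℝ} (hq : 0 < q) (v : ℝ) (n : ℕ) :
    phi H q v ≤ 2 ^ n * phi H (2 ^ n * q) v := by
  induction n with
  | zero => simp
  | succ k ih =>
    have := phi_half hm hH hd (by positivity : 0 < 2 ^ k * q) v
    have h2 : (2:ℝ) ^ (k+1) * q = 2 * (2 ^ k * q) := by ring
    rw [h2]
    have h3 := mul_le_mul_of_nonneg_left this (by positivity : (0:ℝ) ≤ 2 ^ k)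
    rw [pow_succ]
    linarith

lemma phi_nonneg {m : ℝ} (hm : 0 < m) (hH : ∀ α, m * α ^ 2 ≤ H α) (h0 : H 0 = 0) {q : ℝ}
    (hq : 0 < q) (v : ℝ) : 0 ≤ phi H q v := by
  have := le_ciSup (phi_bdd hm hH hq v) 0
  change _ ≤ phi H q v at this
  simpa [h0] using this

lemma phi_cont {m : ℝ} (hm : 0 < m) (hH : ∀ α, m * α ^ 2 ≤ H α) (v : ℝ) :
    ContinuousOn (fun q => phi H q v) (Ioi 0) := by
  have : ConvexOn ℝ (Ioi 0) (fun q => phi H q v) := by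
    refine ⟨convex_Ioi 0, fun x hx y hy a b ha hb hab => ciSup_le fun α => ?_⟩
    have h1 := mul_le_mul_of_nonneg_left (le_ciSup (phi_bdd hm hH hx v) α) ha
    have h2 := mul_le_mul_of_nonneg_left (le_ciSup (phi_bdd hm hH hy v) α) hb
    change _ ≤ a * phi H x v at h1
    change _ ≤ b * phi H y v at h2
    simp only [smul_eq_mul] at *
    have : b = 1 - a := by linarith
    subst this
    linarith
  exact this.continuousOn isOpen_Ioi

lemma phi_meas {m : ℝ} (hm : 0 < m) (hH : ∀ α, m * α ^ 2 ≤ H α) {c : ℝ} (hc : 0 < c) :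
    Measurable (fun z : ℝ × ℝ => phi H (max z.1 c) z.2) := by
  refine LowerSemicontinuous.measurable ?_
  unfold phi
  refine lowerSemicontinuous_ciSup (fun z => phi_bdd hm hH (lt_max_of_lt_right hc) z.2) fun α => ?_
  exact Continuous.lowerSemicontinuous (by fun_prop)

end aux

/-- Let `t > 0` and `f` absolutely continuous on `[0,t]` (with derivative
`f'`) such that `I_t(f) < ∞`. For `x ∈ ℝ` the shifted path `f⁽ˣ⁾(s) = x − f(0) + f(s)`
(with the same derivative) satisfies: `I_t(f⁽ˣ⁾)` is finite for all `x` in a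
neighborhood of `f(0)`, and `I_t(f⁽ˣ⁾) → I_t(f)` as `x → f(0)`. -/
theorem stmt12 (G p : ℝ → ℝ)
    (hGcont : Continuous G) (hGpos : ∀ y, 0 < G y) (hGeven : ∀ y, G (-y) = G y)
    (hGint : Integrable G) (hGprob : ∫ y : ℝ, G y = 1)
    (hGexp : ∀ α : ℝ, Integrable (fun y => Real.exp (α * y) * G y))
    (hpLip : LocallyLipschitz p)
    (pl pu : ℝ) (hpl : 0 < pl) (hp : ∀ x, pl ≤ p x ∧ p x ≤ pu)
    (t : ℝ) (ht : 0 < t) (f f' : ℝ → ℝ)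
    (hf'int : IntegrableOn f' (Icc 0 t))
    (hAC : ∀ s ∈ Icc (0 : ℝ) t, f s = f 0 + ∫ u in (0 : ℝ)..s, f' u)
    (hIfin : IntegrableOn (fun u => Lfun G p (f u) (f' u)) (Icc 0 t)) :
    (∃ δ > (0 : ℝ), ∀ x : ℝ, |x - f 0| < δ →
      IntegrableOn (fun u => Lfun G p (x - f 0 + f u) (f' u)) (Icc 0 t)) ∧
    Tendsto (fun x : ℝ => ∫ u in Icc (0 : ℝ) t, Lfun G p (x - f 0 + f u) (f' u))
      (nhds (f 0)) (nhds (∫ u in Icc (0 : ℝ) t, Lfun G p (f u) (f' u))) := by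
  obtain ⟨m, hm, hH⟩ := aux_H_quad hGcont hGpos hGeven hGint hGexp
  have hd := aux_H_double hGpos hGeven hGint hGexp
  have h0 : Hfun G 0 = 0 := by simp [Hfun]
  have hL : ∀ x v, Lfun G p x v = phi (Hfun G) (p x) v := fun _ _ => rfl
  have hp0 : ∀ x, 0 < p x := fun x => hpl.trans_le (hp x).1
  have hpc : Continuous p := hpLip.continuous
  obtain ⟨n, hn⟩ : ∃ n : ℕ, pu / pl < 2 ^ n := pow_unbounded_of_one_lt _ (by norm_num)
  rw [div_lt_iff₀ hpl] at hn
  have hdom : ∀ x y v, Lfun G p x v ≤ 2 ^ n * Lfun G p y v := fun x y v => by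
    rw [hL, hL]
    refine (phi_anti hm hH hpl (hp x).1 v).trans ((phi_pow hm hH hd hpl v n).trans ?_)
    exact mul_le_mul_of_nonneg_left
      (phi_anti hm hH (hp0 y) ((hp y).2.trans hn.le) v) (by positivity)
  have hnn : ∀ x v, 0 ≤ Lfun G p x v := fun x v => phi_nonneg hm hH h0 (hp0 x) v
  have hfc : ContinuousOn f (Icc 0 t) := by
    have h1 : ContinuousOn (fun s => f 0 + ∫ u in (0 : ℝ)..s, f' u) (Icc 0 t) := by
      have := intervalIntegral.continuousOn_primitive_interval (a := 0) (b := t) (f := f')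
        (μ := volume) (by rwa [uIcc_of_le ht.le])
      rw [uIcc_of_le ht.le] at this
      exact continuousOn_const.add this
    exact h1.congr hAC
  have hfm : AEMeasurable f (volume.restrict (Icc 0 t)) := hfc.aemeasurable measurableSet_Icc
  have hmeas : ∀ x : ℝ, AEStronglyMeasurable (fun u => Lfun G p (x - f 0 + f u) (f' u))
      (volume.restrict (Icc 0 t)) := fun x => by
    have h1 : AEMeasurable (fun u => (p (x - f 0 + f u), f' u)) (volume.restrict (Icc 0 t)) :=
      (hpc.measurable.comp_aemeasurable (hfm.const_add _)).prodMk
        hf'int.aestronglyMeasurable.aemeasurable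
    have h2 := ((phi_meas hm hH hpl).comp_aemeasurable h1).aestronglyMeasurable
    refine h2.congr (Eventually.of_forall fun u => ?_)
    simp only [Function.comp, hL, max_eq_left (hp _).1]
  have hb : ∀ x u, ‖Lfun G p (x - f 0 + f u) (f' u)‖ ≤ 2 ^ n * Lfun G p (f u) (f' u) :=
    fun x u => by
      rw [Real.norm_of_nonneg (hnn _ _)]
      exact hdom _ _ _
  have hbi : IntegrableOn (fun u => 2 ^ n * Lfun G p (f u) (f' u)) (Icc 0 t) :=
    hIfin.const_mul _
  refine ⟨⟨1, one_pos, fun x _ => hbi.mono' (hmeas x) (Eventually.of_forall (hb x))⟩, ?_⟩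
  refine tendsto_integral_filter_of_dominated_convergence _ (Eventually.of_forall hmeas)
    (Eventually.of_forall fun x => Eventually.of_forall (hb x)) hbi
    (Eventually.of_forall fun u => ?_)
  have hc : ContinuousAt (fun x => phi (Hfun G) (p (x - f 0 + f u)) (f' u)) (f 0) := by
    have h1 := (phi_cont hm hH (f' u)).continuousAt (Ioi_mem_nhds (hp0 (f 0 - f 0 + f u)))
    exact ContinuousAt.comp (f := fun x => p (x - f 0 + f u)) h1
      (by fun_prop)
  have := hc.tendsto
  simpa [hL] using this
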